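/- Let F ⊆ ℝ^n be convex and let f : F → ℝ^m be continuous. Suppose there are finitely many closed convex sets R^(1),…,R^(s) ⊆ ℝ^n with F ⊆ R^(1) ∪ … ∪ R^(s), and matrices K^(i) ∈ ℝ^{m×n} and vectors b^(i) ∈ ℝ^m such that f(x) = K^(i) x + b^(i) for all x ∈ R^(i) ∩ F and all i. Then L := max_{1≤i≤s} ‖K^(i)‖_∞ satisfies ‖f(x) − f(x̃)‖_∞ ≤ L ‖x − x̃‖_∞ for all x, x̃ ∈ F. -/

import Mathlib

open Matrix

/-- The induced matrix ∞-norm: maximum absolute row sum. -/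
noncomputable def matNormInf {m n : ℕ} [NeZero m] (K : Matrix (Fin m) (Fin n) ℝ) : ℝ :=
  Finset.univ.sup' Finset.univ_nonempty fun i => ∑ j, |K i j|

open Filter Topology in
/-- If a continuous path on `[a, b]` has its parameter interval covered by finitely many closed sets
on each of which it is Lipschitz with constant `C`, then its endpoints are at distance at most
`C * (b - a)`. -/
theorem norm_sub_le_of_finite_closed_cover {E ι : Type*} [SeminormedAddCommGroup E] [Finite ι]
    {g : ℝ → E} {a b C : ℝ} (hab : a ≤ b) (hg : ContinuousOn g (Set.Icc a b))
    {T : ι → Set ℝ} (hT : ∀ i, IsClosed (T i)) (hcover : Set.Icc a b ⊆ ⋃ i, T i)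
    (hlip : ∀ i, ∀ t ∈ T i ∩ Set.Icc a b, ∀ z ∈ T i ∩ Set.Icc a b, ‖g z - g t‖ ≤ C * |z - t|) :
    ‖g b - g a‖ ≤ C * (b - a) := by
  refine image_le_of_liminf_slope_right_le_deriv_boundary (f := fun t => ‖g t - g a‖)
    (B := fun t => C * (t - a)) (B' := fun _ => C) (by fun_prop) (by simp) (by fun_prop)
    (fun t _ => ?_) (fun t ht r hr => ?_) (Set.right_mem_Icc.2 hab)
  · simpa using (((hasDerivAt_id t).sub_const a).const_mul C).hasDerivWithinAt
  · have hIoo : ∀ᶠ z in 𝓝[>] t, z ∈ Set.Ioo t b := Ioo_mem_nhdsGT ht.2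
    obtain ⟨i, hi⟩ : ∃ i, ∃ᶠ z in 𝓝[>] t, z ∈ T i :=
      frequently_exists.1 (hIoo.mono fun z hz =>
        Set.mem_iUnion.1 (hcover ⟨ht.1.trans hz.1.le, hz.2.le⟩)).frequently
    have hti : t ∈ T i := (hT i).closure_subset
      (mem_closure_iff_frequently.2 (hi.filter_mono nhdsWithin_le_nhds))
    refine (hi.and_eventually hIoo).mono fun z ⟨hzi, hz⟩ => hr.trans_le' ?_
    have hpos : 0 < z - t := sub_pos.2 hz.1
    have hzt := hlip i t ⟨hti, ht.1, ht.2.le⟩ z ⟨hzi, ht.1.trans hz.1.le, hz.2.le⟩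
    rw [abs_of_pos hpos] at hzt
    rw [slope_def_field, div_le_iff₀ hpos]
    have htri := norm_sub_norm_le (g z - g a) (g t - g a)
    rw [sub_sub_sub_cancel_right] at htri
    exact htri.trans hzt

theorem norm_mulVec_le_matNormInf {m n : ℕ} [NeZero m] (K : Matrix (Fin m) (Fin n) ℝ)
    (v : Fin n → ℝ) : ‖K *ᵥ v‖ ≤ matNormInf K * ‖v‖ := by
  refine pi_norm_le_iff_of_nonempty _ |>.2 fun i => ?_
  calc ‖(K *ᵥ v) i‖ ≤ ∑ j, ‖K i j * v j‖ := norm_sum_le Finset.univ fun j => K i j * v j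
    _ ≤ ∑ j, |K i j| * ‖v‖ := by
      gcongr with j
      rw [norm_mul, Real.norm_eq_abs]
      gcongr
      exact norm_le_pi_norm v j
    _ = (∑ j, |K i j|) * ‖v‖ := (Finset.sum_mul ..).symm
    _ ≤ matNormInf K * ‖v‖ := by
      gcongr
      exact Finset.le_sup' (fun i => ∑ j, |K i j|) (Finset.mem_univ i)

/-- A continuous PWA function on a convex domain is Lipschitz (w.r.t. the
∞-norms, which are the sup norms on the pi types) with constant
`max_i ‖K^(i)‖_∞`. -/
theorem stmt_14 {n m s : ℕ} [NeZero m] [NeZero s]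
    (F : Set (Fin n → ℝ)) (hF : Convex ℝ F)
    (f : (Fin n → ℝ) → Fin m → ℝ) (hf : ContinuousOn f F)
    (R : Fin s → Set (Fin n → ℝ))
    (hclosed : ∀ i, IsClosed (R i)) (hconv : ∀ i, Convex ℝ (R i))
    (hcover : F ⊆ ⋃ i, R i)
    (K : Fin s → Matrix (Fin m) (Fin n) ℝ) (b : Fin s → Fin m → ℝ)
    (haff : ∀ i, ∀ x ∈ R i ∩ F, f x = (K i).mulVec x + b i) :
    ∀ x ∈ F, ∀ x' ∈ F,
      ‖f x - f x'‖ ≤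
        (Finset.univ.sup' Finset.univ_nonempty fun i => matNormInf (K i)) *
          ‖x - x'‖ := by
  intro x hx x' hx'
  let γ : ℝ →ᵃ[ℝ] Fin n → ℝ := AffineMap.lineMap x' x
  have hγF : Set.MapsTo γ (Set.Icc 0 1) F := fun t ht => hF.lineMap_mem hx' hx ht
  have hγc : Continuous γ := AffineMap.lineMap_continuous
  have hγsub (z t : ℝ) : γ z - γ t = (z - t) • (x - x') := by
    simp only [γ, AffineMap.lineMap_apply_module']
    module
  have key := norm_sub_le_of_finite_closed_cover (g := f ∘ γ) (T := fun i => γ ⁻¹' R i)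
    (C := (Finset.univ.sup' Finset.univ_nonempty fun i => matNormInf (K i)) * ‖x - x'‖)
    zero_le_one (hf.comp hγc.continuousOn hγF) (fun i => (hclosed i).preimage hγc)
    (fun t ht => by simpa using hcover (hγF ht)) ?_
  · simpa [γ] using key
  · rintro i t ⟨hti, ht⟩ z ⟨hzi, hz⟩
    rw [Function.comp_apply, Function.comp_apply, haff i _ ⟨hzi, hγF hz⟩, haff i _ ⟨hti, hγF ht⟩,
      add_sub_add_right_eq_sub, ← Matrix.mulVec_sub]
    calc ‖K i *ᵥ (γ z - γ t)‖ ≤ matNormInf (K i) * ‖γ z - γ t‖ := norm_mulVec_le_matNormInf _ _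
      _ ≤ (Finset.univ.sup' Finset.univ_nonempty fun i => matNormInf (K i)) * ‖γ z - γ t‖ := by
        gcongr
        exact Finset.le_sup' (fun i => matNormInf (K i)) (Finset.mem_univ i)
      _ = _ := by
        rw [hγsub, norm_smul, Real.norm_eq_abs]
        ring
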